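/- Let q ≥ 1 and n ≥ 2 be integers and let X be a connected (q+1)-regular simple undirected graph on n vertices. If μ(X) ≤ 2, then H_k ≤ 4(n−1) for all integers k ≥ 1. -/

import Mathlib

open Matrix Filter

noncomputable section

/-- The non-backtracking (Hashimoto) matrix of a graph, indexed by darts:
`W e f = 1` if the end of `e` is the start of `f` and `f` is not the reversal of `e`. -/
def hashimoto {n : ℕ} (X : SimpleGraph (Fin n)) [DecidableRel X.Adj] :
    Matrix X.Dart X.Dart ℝ :=
  Matrix.of fun e f => if e.toProd.2 = f.toProd.1 ∧ f ≠ e.symm then 1 else 0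

/-- `N_k = trace(W^k)`, the number of geodesic cycles of length `k`. -/
def Ngc {n : ℕ} (X : SimpleGraph (Fin n)) [DecidableRel X.Adj] (k : ℕ) : ℝ :=
  (hashimoto X ^ k).trace

/-- The sequence `H_k`. -/
def Hseq (q : ℕ) {n : ℕ} (X : SimpleGraph (Fin n)) [DecidableRel X.Adj] (k : ℕ) : ℝ :=
  if Odd k then
    2 * ((n : ℝ) - 1) + Real.sqrt q ^ k + (Real.sqrt q ^ k)⁻¹
      - (Real.sqrt q ^ k)⁻¹ * Ngc X k
  else
    2 * ((n : ℝ) - 1) + Real.sqrt q ^ k + (Real.sqrt q ^ k)⁻¹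
      - (Real.sqrt q ^ k)⁻¹ * (Ngc X k - (n : ℝ) * ((q : ℝ) - 1))

/-- `μ(X) = q^{-1/2} · max_{2 ≤ i ≤ n} |λ_i|`, where `lam` enumerates the eigenvalues
in decreasing order (indices starting from `0`). -/
def mu (q : ℕ) {n : ℕ} (lam : Fin n → ℝ) : ℝ :=
  (Real.sqrt q)⁻¹ * sSup {x : ℝ | ∃ i : Fin n, (i : ℕ) ≠ 0 ∧ x = |lam i|}

namespace SimpleGraph

variable {V : Type*} [DecidableEq V] (G : SimpleGraph V)

/-- The vertex-dart incidence matrix recording the initial vertex of each dart. -/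
def dartSource : Matrix V G.Dart ℝ := Matrix.of fun v e => if e.fst = v then 1 else 0

/-- The vertex-dart incidence matrix recording the terminal vertex of each dart. -/
def dartTarget : Matrix V G.Dart ℝ := Matrix.of fun v e => if e.snd = v then 1 else 0

/-- The permutation matrix of the reversal of darts. -/
def dartReversal : Matrix G.Dart G.Dart ℝ := Matrix.of fun e f => if f = e.symm then 1 else 0

variable [Fintype V] [DecidableRel G.Adj]

theorem dartSource_mul_dartReversal : G.dartSource * G.dartReversal = G.dartTarget := by
  ext v f
  have h (e : G.Dart) : f = e.symm ↔ f.symm = e :=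
    ⟨fun h => by rw [h, Dart.symm_symm], fun h => by rw [← h, Dart.symm_symm]⟩
  simp [mul_apply, dartSource, dartReversal, dartTarget, h]

theorem dartTarget_mul_dartReversal : G.dartTarget * G.dartReversal = G.dartSource := by
  ext v f
  have h (e : G.Dart) : f = e.symm ↔ f.symm = e :=
    ⟨fun h => by rw [h, Dart.symm_symm], fun h => by rw [← h, Dart.symm_symm]⟩
  simp [mul_apply, dartSource, dartReversal, dartTarget, h]

theorem dartReversal_mul_transpose_dartTarget :
    G.dartReversal * G.dartTargetᵀ = G.dartSourceᵀ := by
  ext e v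
  simp [mul_apply, dartSource, dartReversal, dartTarget, -mul_ite]

theorem dartReversal_mul_self : G.dartReversal * G.dartReversal = 1 := by
  ext e f
  simp [mul_apply, dartReversal, one_apply, eq_comm (a := e), -mul_ite]

theorem trace_dartReversal : G.dartReversal.trace = 0 := by
  refine Finset.sum_eq_zero fun e _ => ?_
  simp [dartReversal, e.symm_ne.symm]

theorem dartSource_mul_transpose_dartTarget :
    G.dartSource * G.dartTargetᵀ = G.adjMatrix ℝ := by
  ext u v
  simp only [mul_apply, dartSource, dartTarget, transpose_apply, of_apply, adjMatrix_apply,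
    ← ite_and, mul_ite, mul_one, mul_zero]
  by_cases h : G.Adj u v
  · rw [if_pos h, Finset.sum_eq_single (⟨(u, v), h⟩ : G.Dart)]
    · simp
    · rintro e - he
      refine if_neg fun ⟨h₁, h₂⟩ => he (Dart.ext _ _ (Prod.ext ?_ ?_)) <;> assumption
    · simp
  · rw [if_neg h]
    refine Finset.sum_eq_zero fun e _ => if_neg ?_
    rintro ⟨rfl, rfl⟩
    exact h e.adj

theorem dartTarget_mul_transpose_dartSource :
    G.dartTarget * G.dartSourceᵀ = G.adjMatrix ℝ := by
  rw [← G.transpose_adjMatrix, ← dartSource_mul_transpose_dartTarget, transpose_mul,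
    transpose_transpose]

variable {G}

theorem IsRegularOfDegree.dartSource_mul_transpose {d : ℕ} (h : G.IsRegularOfDegree d) :
    G.dartSource * G.dartSourceᵀ = (d : ℝ) • 1 := by
  ext u v
  by_cases huv : u = v
  · subst huv
    simp [mul_apply, dartSource, ← h u, ← G.dart_fst_fiber_card_eq_degree, ← ite_and]
  · rw [Matrix.smul_apply, one_apply_ne huv, smul_zero, mul_apply]
    refine Finset.sum_eq_zero fun e _ => ?_
    by_cases he : e.fst = u <;> simp [dartSource, he, huv]

theorem IsRegularOfDegree.dartTarget_mul_transpose {d : ℕ} (h : G.IsRegularOfDegree d) :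
    G.dartTarget * G.dartTargetᵀ = (d : ℝ) • 1 := by
  nth_rw 1 [← dartSource_mul_dartReversal]
  rw [Matrix.mul_assoc, dartReversal_mul_transpose_dartTarget, h.dartSource_mul_transpose]

end SimpleGraph

section Hashimoto

open SimpleGraph Polynomial

theorem dickson_one_zero {R : Type*} [CommRing R] (a : R) : dickson 1 a 0 = C 2 := by
  rw [dickson_zero, Nat.cast_one, map_ofNat]
  norm_num

variable {n : ℕ} (X : SimpleGraph (Fin n)) [DecidableRel X.Adj]

theorem hashimoto_eq : hashimoto X = X.dartTargetᵀ * X.dartSource - X.dartReversal := by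
  ext e f
  by_cases hf : f = e.symm
  · subst hf
    simp [hashimoto, mul_apply, dartTarget, dartSource, dartReversal]
  · simp [hashimoto, mul_apply, dartTarget, dartSource, dartReversal, hf, eq_comm]

theorem dartSource_mul_hashimoto :
    X.dartSource * hashimoto X = X.adjMatrix ℝ * X.dartSource - X.dartTarget := by
  rw [hashimoto_eq, Matrix.mul_sub, ← Matrix.mul_assoc, dartSource_mul_transpose_dartTarget,
    dartSource_mul_dartReversal]

variable {X} {q : ℕ}

theorem dartTarget_mul_hashimoto (h : X.IsRegularOfDegree (q + 1)) :
    X.dartTarget * hashimoto X = (q : ℝ) • X.dartSource := by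
  rw [hashimoto_eq, Matrix.mul_sub, ← Matrix.mul_assoc, h.dartTarget_mul_transpose,
    dartTarget_mul_dartReversal, smul_mul, Matrix.one_mul]
  push_cast
  module

theorem dartSource_mul_hashimoto_pow_add_two (h : X.IsRegularOfDegree (q + 1)) (k : ℕ) :
    X.dartSource * hashimoto X ^ (k + 2) =
      X.adjMatrix ℝ * (X.dartSource * hashimoto X ^ (k + 1)) -
        (q : ℝ) • (X.dartSource * hashimoto X ^ k) := by
  rw [pow_succ' _ (k + 1), ← Matrix.mul_assoc, dartSource_mul_hashimoto, Matrix.sub_mul,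
    Matrix.mul_assoc, pow_succ' _ k, ← Matrix.mul_assoc X.dartTarget, dartTarget_mul_hashimoto h,
    smul_mul]

theorem dartSource_mul_hashimoto_pow_mul_sub (h : X.IsRegularOfDegree (q + 1)) :
    ∀ k : ℕ, X.dartSource * hashimoto X ^ (k + 1) * X.dartTargetᵀ -
        X.dartSource * hashimoto X ^ k * X.dartSourceᵀ =
      aeval (X.adjMatrix ℝ) (dickson 1 (q : ℝ) (k + 2) - dickson 1 (q : ℝ) k)
  | 0 => by
    simp only [zero_add, pow_one, pow_zero, Matrix.mul_one, dartSource_mul_hashimoto,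
      Matrix.sub_mul, Matrix.mul_assoc, dartSource_mul_transpose_dartTarget,
      h.dartTarget_mul_transpose, h.dartSource_mul_transpose, dickson_add_two, dickson_one,
      dickson_one_zero, map_sub, map_mul, aeval_X, aeval_C,
      Algebra.algebraMap_eq_smul_one, smul_mul, Matrix.one_mul]
    push_cast
    module
  | 1 => by
    rw [dartSource_mul_hashimoto_pow_add_two h 0]
    simp only [zero_add, pow_one, pow_zero, Matrix.mul_one, dartSource_mul_hashimoto,
      Matrix.sub_mul, Matrix.mul_sub, Matrix.mul_assoc, dartSource_mul_transpose_dartTarget,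
      dartTarget_mul_transpose_dartSource,
      h.dartTarget_mul_transpose, h.dartSource_mul_transpose, dickson_add_two, dickson_one,
      dickson_one_zero, map_sub, map_mul, aeval_X, aeval_C,
      Algebra.algebraMap_eq_smul_one, smul_mul, Matrix.one_mul, Matrix.mul_smul]
    push_cast
    module
  | k + 2 => by
    have ih₀ := dartSource_mul_hashimoto_pow_mul_sub h k
    have ih₁ := dartSource_mul_hashimoto_pow_mul_sub h (k + 1)
    have key : dickson 1 (q : ℝ) (k + 2 + 2) - dickson 1 (q : ℝ) (k + 2) =
        Polynomial.X * (dickson 1 (q : ℝ) (k + 1 + 2) - dickson 1 (q : ℝ) (k + 1)) -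
        C (q : ℝ) * (dickson 1 (q : ℝ) (k + 2) - dickson 1 (q : ℝ) k) := by
      rw [dickson_add_two 1 (q : ℝ) (k + 2), dickson_add_two 1 (q : ℝ) k]
      ring
    rw [key, map_sub, map_mul, map_mul, aeval_X, aeval_C, ← ih₀, ← ih₁,
      show k + 2 + 1 = k + 1 + 2 from rfl, dartSource_mul_hashimoto_pow_add_two h (k + 1),
      dartSource_mul_hashimoto_pow_add_two h k, ← Algebra.smul_def]
    simp only [Matrix.sub_mul, Matrix.mul_sub, smul_mul, Matrix.mul_assoc, smul_sub]
    abel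

theorem hashimoto_pow_succ (k : ℕ) : hashimoto X ^ (k + 1) =
    X.dartTargetᵀ * (X.dartSource * hashimoto X ^ k) - X.dartReversal * hashimoto X ^ k := by
  rw [pow_succ', hashimoto_eq, Matrix.sub_mul, Matrix.mul_assoc]

theorem trace_hashimoto_pow_add_two (h : X.IsRegularOfDegree (q + 1)) (k : ℕ) :
    (hashimoto X ^ (k + 2)).trace = (hashimoto X ^ k).trace +
      (aeval (X.adjMatrix ℝ) (dickson 1 (q : ℝ) (k + 2) - dickson 1 (q : ℝ) k)).trace := by
  rw [← dartSource_mul_hashimoto_pow_mul_sub h, hashimoto_pow_succ (k + 1), trace_sub,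
    trace_mul_comm, hashimoto_pow_succ k, Matrix.mul_sub X.dartReversal,
    ← Matrix.mul_assoc X.dartReversal, ← Matrix.mul_assoc X.dartReversal,
    dartReversal_mul_transpose_dartTarget, dartReversal_mul_self, Matrix.one_mul, trace_sub,
    trace_mul_comm X.dartSourceᵀ, ← hashimoto_pow_succ k, trace_sub]
  ring

/-- The trace formula for regular graphs, expressing the number of geodesic cycles through
Dickson polynomials of the adjacency matrix. -/
theorem trace_hashimoto_pow (h : X.IsRegularOfDegree (q + 1)) : ∀ k : ℕ,
    (hashimoto X ^ k).trace = (aeval (X.adjMatrix ℝ) (dickson 1 (q : ℝ) k)).trace +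
      if Odd k then 0 else (n : ℝ) * (q - 1)
  | 0 => by
    have hc : (Fintype.card X.Dart : ℝ) = n * (q + 1) := by
      rw [X.dart_card_eq_sum_degrees, Finset.sum_congr rfl fun v _ => h v]
      simp
    rw [dickson_one_zero, aeval_C, Algebra.algebraMap_eq_smul_one, trace_smul, pow_zero]
    simp [hc]
    ring
  | 1 => by
    rw [pow_one, hashimoto_eq, trace_sub, trace_mul_comm, dartSource_mul_transpose_dartTarget,
      trace_dartReversal]
    simp
  | k + 2 => by
    rw [trace_hashimoto_pow_add_two h, trace_hashimoto_pow h k, map_sub, trace_sub]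
    simp only [Nat.odd_add, even_two, iff_true]
    ring

end Hashimoto

section Spectral

open Polynomial

theorem Matrix.IsHermitian.trace_aeval {m : Type*} [Fintype m] [DecidableEq m]
    {A : Matrix m m ℝ} (hA : A.IsHermitian) (p : ℝ[X]) :
    (aeval A p).trace = ∑ i, p.eval (hA.eigenvalues i) := by
  have hdiag : aeval (diagonal hA.eigenvalues) p =
      diagonal fun i => p.eval (hA.eigenvalues i) := by
    have := aeval_algHom_apply (diagonalAlgHom (n := m) (α := ℝ) ℝ) hA.eigenvalues p
    rw [diagonalAlgHom_apply, diagonalAlgHom_apply] at this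
    rw [this]
    congr 1
    ext i
    simp [coe_aeval_eq_eval]
  have hconj := aeval_algHom_apply
    (Unitary.conjStarAlgAut ℝ _ hA.eigenvectorUnitary) (diagonal hA.eigenvalues) p
  have hspec : Unitary.conjStarAlgAut ℝ _ hA.eigenvectorUnitary (diagonal hA.eigenvalues) = A :=
    hA.spectral_theorem.symm
  rw [hspec, hdiag, Unitary.conjStarAlgAut_apply] at hconj
  rw [hconj, trace_mul_comm, ← Matrix.mul_assoc, Unitary.coe_star_mul_self, Matrix.one_mul,
    trace_diagonal]

theorem eval_dickson_natCast_add_one (q : ℕ) : ∀ k : ℕ,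
    (dickson 1 (q : ℝ) k).eval ((q : ℝ) + 1) = q ^ k + 1
  | 0 => by norm_num
  | 1 => by simp
  | k + 2 => by
    simp [eval_dickson_natCast_add_one q k, eval_dickson_natCast_add_one q (k + 1)]
    ring

theorem eval_dickson_two_mul_cos (s θ : ℝ) : ∀ k : ℕ,
    (dickson 1 (s ^ 2) k).eval (2 * s * Real.cos θ) = 2 * s ^ k * Real.cos (k * θ)
  | 0 => by norm_num
  | 1 => by simp
  | k + 2 => by
    have h₀ := eval_dickson_two_mul_cos s θ k
    have h₁ := eval_dickson_two_mul_cos s θ (k + 1)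
    have e₀ : (k : ℝ) * θ = (k + 1) * θ - θ := by ring
    have e₂ : ((k : ℝ) + 2) * θ = (k + 1) * θ + θ := by ring
    simp only [dickson_add_two, eval_sub, eval_mul, eval_X, eval_C, h₀, h₁]
    push_cast
    rw [e₀, e₂, Real.cos_sub, Real.cos_add]
    ring

theorem abs_eval_dickson_le {s x : ℝ} (hs : 0 < s) (hx : |x| ≤ 2 * s) (k : ℕ) :
    |(dickson 1 (s ^ 2) k).eval x| ≤ 2 * s ^ k := by
  obtain ⟨h₁, h₂⟩ := abs_le.1 hx
  have hcos : x = 2 * s * Real.cos (Real.arccos (x / (2 * s))) := by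
    rw [Real.cos_arccos (by rw [le_div_iff₀ (by positivity)]; linarith)
      (by rw [div_le_iff₀ (by positivity)]; linarith)]
    field_simp
  rw [hcos, eval_dickson_two_mul_cos, abs_mul, abs_of_nonneg (by positivity)]
  exact mul_le_of_le_one_right (by positivity) (Real.abs_cos_le_one _)

variable {n : ℕ} {X : SimpleGraph (Fin n)} [DecidableRel X.Adj]

theorem SimpleGraph.IsRegularOfDegree.eigenvalues_le {d : ℕ} (h : X.IsRegularOfDegree d)
    (hA : (X.adjMatrix ℝ).IsHermitian) (i : Fin n) : hA.eigenvalues i ≤ d := by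
  have hev : Module.End.HasEigenvalue (Matrix.toLin' (X.adjMatrix ℝ)) (hA.eigenvalues i) := by
    rw [Module.End.hasEigenvalue_iff_mem_spectrum, Matrix.spectrum_toLin']
    exact hA.eigenvalues_mem_spectrum_real i
  obtain ⟨k, hk⟩ := eigenvalue_mem_ball hev
  rw [Metric.mem_closedBall, Real.dist_eq] at hk
  have hsum : ∑ j ∈ Finset.univ.erase k, ‖X.adjMatrix ℝ k j‖ ≤ d := by
    calc _ ≤ ∑ j, ‖X.adjMatrix ℝ k j‖ :=
          Finset.sum_le_sum_of_subset_of_nonneg (Finset.erase_subset _ _)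
            fun _ _ _ => norm_nonneg _
      _ = d := by
        simp [SimpleGraph.adjMatrix_apply, apply_ite, ← h k,
          ← SimpleGraph.card_neighborFinset_eq_degree, SimpleGraph.neighborFinset_eq_filter]
  have := (le_abs_self _).trans (hk.trans hsum)
  simpa using this

theorem SimpleGraph.IsRegularOfDegree.exists_eigenvalues_eq [NeZero n] {d : ℕ}
    (h : X.IsRegularOfDegree d)
    (hA : (X.adjMatrix ℝ).IsHermitian) : ∃ i, hA.eigenvalues i = d := by
  have hev : Module.End.HasEigenvalue (Matrix.toLin' (X.adjMatrix ℝ)) (d : ℝ) := by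
    refine Module.End.hasEigenvalue_of_hasEigenvector (x := Function.const _ 1) ⟨?_, ?_⟩
    · rw [Module.End.mem_eigenspace_iff]
      ext v
      rw [Matrix.toLin'_apply, SimpleGraph.adjMatrix_mulVec_const_apply_of_regular h]
      simp
    · exact fun h0 => one_ne_zero (congrFun h0 0)
  rw [Module.End.hasEigenvalue_iff_mem_spectrum, Matrix.spectrum_toLin',
    hA.spectrum_real_eq_range_eigenvalues] at hev
  exact hev

end Spectral

open Polynomial in
theorem Hk_le_of_mu_le_two {q n : ℕ} (hq : 1 ≤ q) (hn : 2 ≤ n)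
    (X : SimpleGraph (Fin n)) [DecidableRel X.Adj]
    (hconn : X.Connected) (hreg : X.IsRegularOfDegree (q + 1))
    (hA : (X.adjMatrix ℝ).IsHermitian)
    (lam : Fin n → ℝ)
    (hperm : ∃ σ : Equiv.Perm (Fin n), ∀ i, lam i = hA.eigenvalues (σ i))
    (hanti : ∀ i j : Fin n, i ≤ j → lam j ≤ lam i)
    (hmu : mu q lam ≤ 2) :
    ∀ k : ℕ, 1 ≤ k → Hseq q X k ≤ 4 * ((n : ℝ) - 1) := by
  have : NeZero n := ⟨by omega⟩
  obtain ⟨σ, hσ⟩ := hperm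
  have hs : 0 < Real.sqrt q := Real.sqrt_pos.2 (by exact_mod_cast hq)
  have hs2 : Real.sqrt q ^ 2 = q := Real.sq_sqrt (Nat.cast_nonneg q)
  have hlam0 : lam 0 = (q : ℝ) + 1 := by
    obtain ⟨j, hj⟩ := hreg.exists_eigenvalues_eq hA
    refine le_antisymm ?_ ?_
    · simpa [hσ] using hreg.eigenvalues_le hA (σ 0)
    · simpa [hσ, hj] using hanti 0 (σ.symm j) (Fin.zero_le _)
  have hbound (i : Fin n) (hi : i ≠ 0) : |lam i| ≤ 2 * Real.sqrt q := by
    have hbdd : BddAbove {x : ℝ | ∃ i : Fin n, (i : ℕ) ≠ 0 ∧ x = |lam i|} :=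
      ((Set.finite_range fun i => |lam i|).subset
        (by rintro x ⟨i, -, rfl⟩; exact ⟨i, rfl⟩)).bddAbove
    refine (le_csSup hbdd ⟨i, Fin.val_ne_zero_iff.2 hi, rfl⟩).trans ?_
    rw [mu, inv_mul_le_iff₀ hs] at hmu
    linarith
  intro k _
  have htr : ((aeval (X.adjMatrix ℝ)) (dickson 1 (q : ℝ) k)).trace =
      q ^ k + 1 + ∑ i ∈ Finset.univ.erase 0, (dickson 1 (q : ℝ) k).eval (lam i) := by
    rw [hA.trace_aeval, ← Equiv.sum_comp σ, ← Finset.add_sum_erase _ _ (Finset.mem_univ 0)]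
    simp only [← hσ, hlam0, eval_dickson_natCast_add_one]
  have hsum : -(2 * Real.sqrt q ^ k * ((n : ℝ) - 1)) ≤
      ∑ i ∈ Finset.univ.erase 0, (dickson 1 (q : ℝ) k).eval (lam i) := by
    have := Finset.card_nsmul_le_sum (Finset.univ.erase (0 : Fin n))
      (fun i => (dickson 1 (q : ℝ) k).eval (lam i)) (-(2 * Real.sqrt q ^ k)) fun i hi => by
        have := abs_eval_dickson_le hs (hbound i (Finset.ne_of_mem_erase hi)) k
        rw [hs2] at this
        exact (abs_le.1 this).1
    rw [Finset.card_erase_of_mem (Finset.mem_univ _), Finset.card_univ, Fintype.card_fin,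
      nsmul_eq_mul, Nat.cast_sub (by omega)] at this
    push_cast at this
    linarith
  have hH : Hseq q X k = 2 * ((n : ℝ) - 1) + Real.sqrt q ^ k + (Real.sqrt q ^ k)⁻¹
      - (Real.sqrt q ^ k)⁻¹ * ((aeval (X.adjMatrix ℝ)) (dickson 1 (q : ℝ) k)).trace := by
    rw [Hseq, Ngc, trace_hashimoto_pow hreg]
    split_ifs <;> simp
  have hqk : (q : ℝ) ^ k = Real.sqrt q ^ k * Real.sqrt q ^ k := by
    rw [← mul_pow, ← sq, hs2]
  have hk : 0 < Real.sqrt q ^ k := pow_pos hs k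
  rw [hH, htr, hqk]
  generalize Real.sqrt q ^ k = t at *
  have := mul_le_mul_of_nonneg_left hsum (inv_nonneg.2 hk.le)
  have e₁ : t⁻¹ * (2 * t * ((n : ℝ) - 1)) = 2 * ((n : ℝ) - 1) := by field_simp
  have e₂ : t⁻¹ * (t * t) = t := by field_simp
  rw [mul_neg, e₁] at this
  rw [mul_add, mul_add, e₂, mul_one]
  linarith
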